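/- arXiv:1508.01839 — 6 statements merged into one kernel-verified Lean document; each statement's English description precedes it below -/
import Mathlib

section
/- If a q-Steiner system S_q(t,k,n) exists, then for each integer i with 1 ≤ i ≤ t−1 a q-Steiner system S_q(t−i, k−i, n−i) exists. That is, if there is a set S of k-dimensional subspaces of 𝔽^n such that every t-dimensional subspace of 𝔽^n is contained in exactly one member of S, then there is a set S' of (k−i)-dimensional subspaces of 𝔽^(n−i) such that every (t−i)-dimensional subspace of 𝔽^(n−i) is contained in exactly one member of S'. -/
/-- A `q`-Steiner system `S_q(t,k,n)`: a set `S` of `k`-dimensional subspaces (blocks) of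
`F^n` such that every `t`-dimensional subspace of `F^n` is contained in exactly one block. -/
def IsSteinerSystem (F : Type) [Field F] (t k n : ℕ)
    (S : Set (Submodule F (Fin n → F))) : Prop :=
  (∀ B ∈ S, Module.finrank F B = k) ∧
  ∀ T : Submodule F (Fin n → F), Module.finrank F T = t → ∃! B, B ∈ S ∧ T ≤ B

/-- The preimage of a subspace under a surjective linear map has the dimension of the subspace
plus the dimension of the kernel. -/
theorem finrank_comap_of_surjective {F V W : Type*} [Field F] [AddCommGroup V] [Module F V]
    [AddCommGroup W] [Module F W] [FiniteDimensional F V] (f : V →ₗ[F] W)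
    (hf : Function.Surjective f) (p : Submodule F W) :
    Module.finrank F (p.comap f) = Module.finrank F p + Module.finrank F (LinearMap.ker f) := by
  have h := LinearMap.finrank_range_add_finrank_ker (f.domRestrict (p.comap f))
  rw [LinearMap.range_domRestrict, Submodule.map_comap_eq_of_surjective hf,
    LinearMap.ker_domRestrict] at h
  have hk : LinearMap.ker f ≤ p.comap f := LinearMap.ker_le_comap f
  rw [← h]
  congr 1
  exact (Submodule.comapSubtypeEquivOfLe hk).finrank_eq

/-- If a `q`-Steiner system `S_q(t,k,n)` exists, then for each `i` with `1 ≤ i ≤ t-1`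
a `q`-Steiner system `S_q(t-i, k-i, n-i)` exists. -/
theorem derived_steiner_exists (F : Type) [Field F] [Fintype F]
    (t k n i : ℕ) (htk : t ≤ k) (hkn : k ≤ n) (hi1 : 1 ≤ i) (hi2 : i ≤ t - 1)
    (h : ∃ S : Set (Submodule F (Fin n → F)), IsSteinerSystem F t k n S) :
    ∃ S' : Set (Submodule F (Fin (n - i) → F)),
      IsSteinerSystem F (t - i) (k - i) (n - i) S' := by
  obtain ⟨S, hS, hT⟩ := h
  let f : (Fin n → F) →ₗ[F] (Fin (n - i) → F) :=
    LinearMap.funLeft F F (Fin.castLE (Nat.sub_le n i))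
  have hf : Function.Surjective f :=
    LinearMap.funLeft_surjective_of_injective F F _ (Fin.castLE_injective _)
  have hker : Module.finrank F (LinearMap.ker f) = i := by
    have := LinearMap.finrank_range_add_finrank_ker f
    rw [LinearMap.range_eq_top.2 hf, finrank_top, Module.finrank_fin_fun,
      Module.finrank_fin_fun] at this
    omega
  have hcomap (p : Submodule F (Fin (n - i) → F)) :
      Module.finrank F (p.comap f) = Module.finrank F p + i := by
    rw [finrank_comap_of_surjective f hf, hker]
  refine ⟨{B | B.comap f ∈ S}, fun B hB => ?_, fun T hTd => ?_⟩
  · have h₁ := hS _ hB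
    rw [hcomap] at h₁
    omega
  · obtain ⟨B, ⟨hBS, hTB⟩, huniq⟩ := hT (T.comap f) (by rw [hcomap]; omega)
    have hB : (B.map f).comap f = B :=
      Submodule.comap_map_eq_self ((LinearMap.ker_le_comap f).trans hTB)
    refine ⟨B.map f, ⟨?_, ?_⟩, fun C hC => ?_⟩
    · rwa [Set.mem_ofPred_eq, hB]
    · rwa [← Submodule.comap_le_comap_iff_of_surjective hf, hB]
    · rw [← huniq _ ⟨hC.1, Submodule.comap_mono hC.2⟩,
        Submodule.map_comap_eq_of_surjective hf]
end

section
/- Let X be a t-dimensional subspace of 𝔽^n. Then the number of t-dimensional subspaces Y of 𝔽^(n+1) satisfying π(Y) = X is exactly q^t, where π : 𝔽^(n+1) → 𝔽^n is the linear projection deleting the last coordinate. (In the paper's language: a t-subspace of 𝔽^n can be extended in exactly q^t distinct ways to a t-subspace of 𝔽^(n+1).) -/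
/-- The linear projection deleting the last coordinate. -/
def delLast (F : Type) [Field F] (n : ℕ) : (Fin (n + 1) → F) →ₗ[F] (Fin n → F) :=
  LinearMap.funLeft F F Fin.castSucc

@[simp]
theorem delLast_apply (F : Type) [Field F] (n : ℕ) (v : Fin (n + 1) → F) (i : Fin n) :
    delLast F n v i = v i.castSucc := rfl

/-- The map `x ↦ (x, φ x)` appending to a vector of `X` the value of a functional on `X`. -/
def appendFunctional {F : Type} [Field F] {n : ℕ} (X : Submodule F (Fin n → F))
    (φ : Module.Dual F X) : X →ₗ[F] (Fin (n + 1) → F) :=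
  LinearMap.pi (Fin.snoc (α := fun _ => X →ₗ[F] F) (fun i => LinearMap.proj i ∘ₗ X.subtype) φ)

section appendFunctional

variable {F : Type} [Field F] {n : ℕ} {X : Submodule F (Fin n → F)}

@[simp]
theorem appendFunctional_castSucc (φ : Module.Dual F X) (x : X) (i : Fin n) :
    appendFunctional X φ x i.castSucc = (x : Fin n → F) i := by
  simp [appendFunctional]

@[simp]
theorem appendFunctional_last (φ : Module.Dual F X) (x : X) :
    appendFunctional X φ x (Fin.last n) = φ x := by
  simp [appendFunctional]

@[simp]
theorem delLast_comp_appendFunctional (φ : Module.Dual F X) :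
    delLast F n ∘ₗ appendFunctional X φ = X.subtype := by
  ext x i
  simp

theorem appendFunctional_injective (φ : Module.Dual F X) :
    Function.Injective (appendFunctional X φ) := by
  apply Function.Injective.of_comp (f := delLast F n)
  rw [← LinearMap.coe_comp, delLast_comp_appendFunctional]
  exact X.injective_subtype

theorem range_appendFunctional_injective :
    Function.Injective fun φ : Module.Dual F X => LinearMap.range (appendFunctional X φ) := by
  intro φ ψ h
  ext x
  obtain ⟨y, hy⟩ : appendFunctional X φ x ∈ LinearMap.range (appendFunctional X ψ) :=
    h.le (LinearMap.mem_range_self _ x)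
  obtain rfl : y = x := by
    ext i
    simpa using congrFun hy i.castSucc
  simpa using (congrFun hy (Fin.last n)).symm

/-- The extensions of `X` of the same dimension are the graphs of the functionals on `X`. -/
theorem range_range_appendFunctional :
    (Set.range fun φ : Module.Dual F X => LinearMap.range (appendFunctional X φ)) =
      {Y : Submodule F (Fin (n + 1) → F) |
        Module.finrank F Y = Module.finrank F X ∧ Submodule.map (delLast F n) Y = X} := by
  ext Y
  constructor
  · rintro ⟨φ, rfl⟩
    refine ⟨LinearMap.finrank_range_of_inj (appendFunctional_injective φ), ?_⟩
    rw [← LinearMap.range_comp, delLast_comp_appendFunctional, Submodule.range_subtype]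
  · rintro ⟨hd, hm⟩
    let p : Y →ₗ[F] X :=
      (delLast F n).restrict fun y hy => hm ▸ Submodule.mem_map_of_mem hy
    have hp : Function.Surjective p := by
      rintro ⟨x, hx⟩
      obtain ⟨y, hy, rfl⟩ := hm.symm ▸ hx
      exact ⟨⟨y, hy⟩, rfl⟩
    let e : Y ≃ₗ[F] X := LinearEquiv.ofBijective p
      ⟨(LinearMap.injective_iff_surjective_of_finrank_eq_finrank hd).2 hp, hp⟩
    let φ : Module.Dual F X := LinearMap.proj (Fin.last n) ∘ₗ Y.subtype ∘ₗ e.symm.toLinearMap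
    have hφ : appendFunctional X φ ∘ₗ e.toLinearMap = Y.subtype := by
      refine LinearMap.ext fun y => funext fun i => ?_
      induction i using Fin.lastCases with
      | last => simp [φ]
      | cast i => exact appendFunctional_castSucc φ (e y) i
    refine ⟨φ, ?_⟩
    rw [← Submodule.range_subtype Y, ← hφ, LinearEquiv.range_comp]

end appendFunctional

/-- A `t`-subspace of `F^n` can be extended in exactly `q^t` distinct ways to a
`t`-subspace of `F^{n+1}`: the number of `t`-dimensional subspaces `Y` of `F^{n+1}`
whose puncturing (image under deleting the last coordinate) equals `X` is `q^t`. -/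
theorem extensions_same_dim_card (q : ℕ) (F : Type) [Field F] [Fintype F]
    (hq : Fintype.card F = q) (n t : ℕ)
    (X : Submodule F (Fin n → F)) (hX : Module.finrank F X = t) :
    {Y : Submodule F (Fin (n + 1) → F) |
        Module.finrank F Y = t ∧ Submodule.map (delLast F n) Y = X}.ncard = q ^ t := by
  subst hq hX
  rw [← range_range_appendFunctional, ← Set.image_univ,
    Set.ncard_image_of_injective _ range_appendFunctional_injective, Set.ncard_univ,
    Module.natCard_eq_pow_finrank (K := F), Subspace.dual_finrank_eq, Nat.card_eq_fintype_card]
end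

section
/- Let S be a q-Steiner system S_q(2,3,7) containing the block Z₁ = {x ∈ 𝔽^7 : x₁ = x₂ = x₃ = x₄ = 0}. Then the number of blocks B ∈ S with B ≠ Z₁ whose intersection with Z₁ is nontrivial (i.e., B ∩ Z₁ ≠ {0}) is exactly q²(q² + 1)(q² + q + 1). -/
/-- The subspace of vectors of `F^n` vanishing on a given set of coordinates. -/
def coordZero (F : Type) [Field F] {n : ℕ} (s : Set (Fin n)) :
    Submodule F (Fin n → F) where
  carrier := {x | ∀ i ∈ s, x i = 0}
  add_mem' := by
    intro a b ha hb i hi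
    simp [ha i hi, hb i hi]
  zero_mem' := by intro i _; rfl
  smul_mem' := by
    intro c x hx i hi
    simp [hx i hi]

open Module in
theorem card_filter_mem_submodule {F V : Type*} [Field F] [Fintype F] [AddCommGroup V] [Module F V]
    [Fintype V] (W : Submodule F V) [DecidablePred (· ∈ W)] :
    (Finset.univ.filter (· ∈ W)).card = Fintype.card F ^ finrank F W := by
  rw [← Fintype.card_subtype, ← Nat.card_eq_fintype_card, ← Nat.card_eq_fintype_card]
  exact natCard_eq_pow_finrank (K := F) (V := W)

open Module in
theorem card_filter_mem_submodule_ne_zero {F V : Type*} [Field F] [Fintype F] [AddCommGroup V]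
    [Module F V] [Fintype V] [DecidableEq V] (W : Submodule F V) [DecidablePred (· ∈ W)] :
    (Finset.univ.filter (fun v => v ∈ W ∧ v ≠ 0)).card = Fintype.card F ^ finrank F W - 1 := by
  have h : Finset.univ.filter (fun v => v ∈ W ∧ v ≠ 0) =
      (Finset.univ.filter (· ∈ W)).erase 0 := by
    ext v
    simp [and_comm]
  rw [h, Finset.card_erase_of_mem (by simp), card_filter_mem_submodule]

open Module in
theorem card_filter_mem_submodule_notMem {F V : Type*} [Field F] [Fintype F] [AddCommGroup V]
    [Module F V] [Fintype V] (W U : Submodule F V) [DecidablePred (· ∈ W)]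
    [DecidablePred (· ∈ U)] :
    (Finset.univ.filter (fun v => v ∈ W ∧ v ∉ U)).card =
      Fintype.card F ^ finrank F W - Fintype.card F ^ finrank F ↥(W ⊓ U) := by
  classical
  have h : Finset.univ.filter (fun v => v ∈ W ∧ v ∉ U) =
      Finset.univ.filter (· ∈ W) \ Finset.univ.filter (· ∈ W ⊓ U) := by
    ext v
    simp +contextual
  rw [h, Finset.card_sdiff_of_subset, card_filter_mem_submodule, card_filter_mem_submodule]
  intro v
  simp +contextual

namespace IsSteinerSystem

variable {F : Type} [Field F] {k n : ℕ} {S : Set (Submodule F (Fin n → F))}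

/-- Two vectors, one in a subspace and nonzero and the other outside of it, lie in a unique block. -/
theorem existsUnique_block_of_mem_of_notMem (hS : IsSteinerSystem F 2 k n S)
    {Z : Submodule F (Fin n → F)} {v w : Fin n → F} (hv : v ∈ Z) (hv0 : v ≠ 0) (hw : w ∉ Z) :
    ∃! B, B ∈ S ∧ v ∈ B ∧ w ∈ B := by
  have hli : LinearIndependent F ![v, w] := by
    rw [LinearIndependent.pair_iff' hv0]
    rintro a rfl
    exact hw (Z.smul_mem a hv)
  have hrank := finrank_span_eq_card hli
  rw [Fintype.card_fin] at hrank
  simpa [Submodule.span_le, Set.insert_subset_iff, and_comm (a := v ∈ _)] using hS.2 _ hrank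

/-- Distinct blocks that meet nontrivially meet in a one-dimensional subspace. -/
theorem finrank_inf_eq_one (hS : IsSteinerSystem F 2 k n S) {B Z : Submodule F (Fin n → F)}
    (hB : B ∈ S) (hZ : Z ∈ S) (hne : B ≠ Z) (hinf : B ⊓ Z ≠ ⊥) :
    Module.finrank F ↥(B ⊓ Z) = 1 := by
  refine le_antisymm ?_ (Submodule.one_le_finrank_iff.mpr hinf)
  obtain ⟨v, hv, hv0⟩ := (Submodule.ne_bot_iff _).mp hinf
  refine finrank_le_one ⟨v, hv⟩ fun w => ?_
  by_contra! hw
  have hw' : w.1 ∉ Submodule.span F {v} := by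
    rw [Submodule.mem_span_singleton]
    rintro ⟨c, hc⟩
    exact hw c (Subtype.ext hc)
  exact hne ((hS.existsUnique_block_of_mem_of_notMem
    (Submodule.mem_span_singleton_self v) hv0 hw').unique
    ⟨hB, hv.1, w.2.1⟩ ⟨hZ, hv.2, w.2.2⟩)

/-- Double counting of the pairs consisting of a nonzero vector of the block `Z` and a vector
outside of `Z`, according to the block they span. -/
theorem ncard_meet_mul [Fintype F] (hS : IsSteinerSystem F 2 k n S)
    {Z : Submodule F (Fin n → F)} (hZ : Z ∈ S) :
    {B ∈ S | B ≠ Z ∧ B ⊓ Z ≠ ⊥}.ncard *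
        ((Fintype.card F - 1) * (Fintype.card F ^ k - Fintype.card F)) =
      (Fintype.card F ^ k - 1) * (Fintype.card F ^ n - Fintype.card F ^ k) := by
  classical
  have hfin : {B ∈ S | B ≠ Z ∧ B ⊓ Z ≠ ⊥}.Finite := Set.toFinite _
  let T : Finset ((Fin n → F) × (Fin n → F)) :=
    Finset.univ.filter (fun v => v ∈ Z ∧ v ≠ 0) ×ˢ
      Finset.univ.filter (fun w => w ∈ (⊤ : Submodule F (Fin n → F)) ∧ w ∉ Z)
  have hT : T.card =
      (Fintype.card F ^ k - 1) * (Fintype.card F ^ n - Fintype.card F ^ k) := by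
    rw [Finset.card_product, card_filter_mem_submodule_ne_zero, card_filter_mem_submodule_notMem,
      top_inf_eq, hS.1 Z hZ, finrank_top, Module.finrank_fin_fun]
  rw [Set.ncard_eq_toFinset_card _ hfin, ← hT, ← mul_one T.card]
  refine Finset.card_mul_eq_card_mul (fun B p => p.1 ∈ B ∧ p.2 ∈ B) ?_ ?_
  · intro B hB
    obtain ⟨hBS, hne, hinf⟩ : B ∈ S ∧ B ≠ Z ∧ B ⊓ Z ≠ ⊥ := hfin.mem_toFinset.mp hB
    have hfiber : Finset.bipartiteAbove (fun B p => p.1 ∈ B ∧ p.2 ∈ B) T B =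
        Finset.univ.filter (fun v => v ∈ B ⊓ Z ∧ v ≠ 0) ×ˢ
          Finset.univ.filter (fun w => w ∈ B ∧ w ∉ Z) := by
      ext p
      simp only [T, Finset.mem_bipartiteAbove, Finset.mem_product, Finset.mem_filter,
        Finset.mem_univ, Submodule.mem_top, Submodule.mem_inf]
      tauto
    rw [hfiber, Finset.card_product, card_filter_mem_submodule_ne_zero,
      card_filter_mem_submodule_notMem, hS.finrank_inf_eq_one hBS hZ hne hinf, hS.1 B hBS, pow_one]
  · rintro ⟨v, w⟩ hp
    obtain ⟨⟨hv, hv0⟩, hw⟩ : (v ∈ Z ∧ v ≠ 0) ∧ w ∉ Z := by simpa [T] using hp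
    obtain ⟨B, ⟨hBS, hvB, hwB⟩, huniq⟩ := hS.existsUnique_block_of_mem_of_notMem hv hv0 hw
    rw [Finset.card_eq_one]
    refine ⟨B, Finset.ext fun C => ?_⟩
    simp only [Finset.mem_bipartiteBelow, Set.Finite.mem_toFinset, Set.mem_ofPred_eq,
      Finset.mem_singleton]
    constructor
    · rintro ⟨⟨hCS, -⟩, hC⟩
      exact huniq C ⟨hCS, hC⟩
    · rintro rfl
      refine ⟨⟨hBS, ?_, (Submodule.ne_bot_iff _).mpr ⟨v, ⟨hvB, hv⟩, hv0⟩⟩, hvB, hwB⟩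
      rintro rfl
      exact hw hwB

end IsSteinerSystem

/-- In a `q`-Steiner system `S_q(2,3,7)` containing the block
`Z₁ = {x : x₁ = x₂ = x₃ = x₄ = 0}`, the number of blocks `B ≠ Z₁` with
`B ⊓ Z₁ ≠ ⊥` is exactly `q²(q²+1)(q²+q+1)`. -/
theorem steiner_237_meet_Z1_count (q : ℕ) (F : Type) [Field F] [Fintype F]
    (hq : Fintype.card F = q)
    (S : Set (Submodule F (Fin 7 → F))) (hS : IsSteinerSystem F 2 3 7 S)
    (hZ1 : coordZero F ({0, 1, 2, 3} : Set (Fin 7)) ∈ S) :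
    {B ∈ S | B ≠ coordZero F ({0, 1, 2, 3} : Set (Fin 7)) ∧
        B ⊓ coordZero F ({0, 1, 2, 3} : Set (Fin 7)) ≠ ⊥}.ncard =
      q ^ 2 * (q ^ 2 + 1) * (q ^ 2 + q + 1) := by
  have h := hS.ncard_meet_mul hZ1
  have hq1 : 1 < q := hq ▸ Fintype.one_lt_card
  rw [hq] at h
  have hle : q < q ^ 3 := lt_self_pow₀ hq1 (by norm_num)
  have hle' : q ^ 3 ≤ q ^ 7 := Nat.pow_le_pow_right hq1.le (by norm_num)
  have hpos : 0 < (q - 1) * (q ^ 3 - q) := Nat.mul_pos (by omega) (by omega)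
  refine Nat.eq_of_mul_eq_mul_right hpos (h.trans ?_)
  zify [hq1.le, hle.le, hle', hq1.le.trans hle.le]
  ring
end

section
/- Let S be a q-Steiner system S_q(2,3,7) containing the block Z₁ = {x ∈ 𝔽^7 : x₁ = x₂ = x₃ = x₄ = 0}, and suppose there exists a block X ∈ S with X ∩ Z₁ = {0} whose image under the linear projection ρ : 𝔽^7 → 𝔽^4 onto the first four coordinates equals the subspace {y ∈ 𝔽^4 : y₄ = 0}. Then there exists a linear equivalence f : 𝔽^7 ≃ 𝔽^7 satisfying (f x)ᵢ = xᵢ for all x and all i ∈ {1,2,3,4}, such that the image system { f(B) : B ∈ S } is a q-Steiner system S_q(2,3,7) containing both Z₁ and Z₂ = {x ∈ 𝔽^7 : x₄ = x₅ = x₆ = x₇ = 0}. (In the paper's language: one may assume without loss of generality that both the 3-subspace with four leading all-zero columns and the 3-subspace with four trailing all-zero columns are blocks.) -/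
/-- The linear projection of `F^7` onto its first four coordinates. -/
def projFirst4 (F : Type) [Field F] : (Fin 7 → F) →ₗ[F] (Fin 4 → F) :=
  LinearMap.funLeft F F (Fin.castLE (by omega))

/-- The image of a `q`-Steiner system under a linear equivalence is a `q`-Steiner system. -/
theorem IsSteinerSystem.map_linearEquiv {F : Type} [Field F] {t k n : ℕ}
    {S : Set (Submodule F (Fin n → F))} (hS : IsSteinerSystem F t k n S)
    (f : (Fin n → F) ≃ₗ[F] (Fin n → F)) :
    IsSteinerSystem F t k n (Submodule.map f.toLinearMap '' S) := by
  refine ⟨?_, fun T hT => ?_⟩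
  · rintro _ ⟨B, hB, rfl⟩
    exact (LinearEquiv.finrank_map_eq f B).trans (hS.1 B hB)
  · obtain ⟨B, ⟨hB, hTB⟩, huniq⟩ := hS.2 (T.map f.symm.toLinearMap)
      ((LinearEquiv.finrank_map_eq f.symm T).trans hT)
    have le_iff (C : Submodule F (Fin n → F)) :
        T ≤ C.map f.toLinearMap ↔ T.map f.symm.toLinearMap ≤ C := by
      rw [Submodule.map_le_iff_le_comap]
      exact iff_of_eq (congrArg (T ≤ ·) (Submodule.map_equiv_eq_comap_symm f C))
    refine ⟨B.map f.toLinearMap, ⟨⟨B, hB, rfl⟩, (le_iff B).2 hTB⟩, ?_⟩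
    rintro _ ⟨⟨C, hC, rfl⟩, hTC⟩
    rw [huniq C ⟨hC, (le_iff C).1 hTC⟩]

/-- For `g` with `g ∘ g = 0`, the linear equivalence `x ↦ x - g x`. -/
def LinearEquiv.subOfSqZero {R M : Type*} [Ring R] [AddCommGroup M] [Module R M]
    (g : M →ₗ[R] M) (hg : ∀ x, g (g x) = 0) : M ≃ₗ[R] M :=
  LinearEquiv.ofLinearMap (LinearMap.id - g) (LinearMap.id + g)
    (by ext1 x; simp [hg]) (by ext1 x; simp [hg])

/-- If a `q`-Steiner system `S_q(2,3,7)` contains `Z₁ = {x : x₁ = x₂ = x₃ = x₄ = 0}`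
and has a block `X` with `X ⊓ Z₁ = 0` projecting onto the first four coordinates to
`{y ∈ F⁴ : y₄ = 0}`, then there is a linear equivalence of `F^7` fixing the first
four coordinates that carries `S` to a `q`-Steiner system containing both `Z₁` and
`Z₂ = {x : x₄ = x₅ = x₆ = x₇ = 0}`. -/
theorem steiner_wlog_Z1_Z2 (F : Type) [Field F] [Fintype F]
    (S : Set (Submodule F (Fin 7 → F))) (hS : IsSteinerSystem F 2 3 7 S)
    (hZ1 : coordZero F ({0, 1, 2, 3} : Set (Fin 7)) ∈ S)
    (hX : ∃ X ∈ S, X ⊓ coordZero F ({0, 1, 2, 3} : Set (Fin 7)) = ⊥ ∧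
      Submodule.map (projFirst4 F) X = coordZero F ({3} : Set (Fin 4))) :
    ∃ f : (Fin 7 → F) ≃ₗ[F] (Fin 7 → F),
      (∀ x : Fin 7 → F, ∀ i ∈ ({0, 1, 2, 3} : Set (Fin 7)), f x i = x i) ∧
      IsSteinerSystem F 2 3 7 (Submodule.map f.toLinearMap '' S) ∧
      coordZero F ({0, 1, 2, 3} : Set (Fin 7)) ∈ Submodule.map f.toLinearMap '' S ∧
      coordZero F ({3, 4, 5, 6} : Set (Fin 7)) ∈ Submodule.map f.toLinearMap '' S := by
  obtain ⟨X, hXS, hXZ, hXp⟩ := hX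
  have lift (i : Fin 3) :
      ∃ v ∈ X, projFirst4 F v = Pi.single (Fin.castLE (by omega) i) 1 := by
    have : (Pi.single (Fin.castLE (by omega) i) 1 : Fin 4 → F) ∈
        Submodule.map (projFirst4 F) X := by
      rw [hXp]
      rintro j rfl
      fin_cases i <;> simp
    exact this
  choose v hvX hv using lift
  have hvc (i : Fin 3) (j : Fin 4) :
      v i (Fin.castLE (by omega) j) = if j = Fin.castLE (by omega) i then 1 else 0 := by
    simpa [projFirst4, LinearMap.funLeft_apply, Pi.single_apply] using congrFun (hv i) j
  let ι : Fin 3 → Fin 7 := Fin.castLE (by omega)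
  let g : (Fin 7 → F) →ₗ[F] (Fin 7 → F) :=
    ∑ i, (LinearMap.proj (ι i)).smulRight (v i - Pi.single (ι i) 1)
  have g_apply (x : Fin 7 → F) : g x = ∑ i, x (ι i) • (v i - Pi.single (ι i) 1) := by
    simp [g]
  have w_zero (i : Fin 3) (j : Fin 4) :
      (v i - Pi.single (ι i) 1 : Fin 7 → F) (Fin.castLE (by omega) j) = 0 := by
    rw [Pi.sub_apply, hvc, Pi.single_apply]
    simp [ι, Fin.ext_iff]
  have g_head (x : Fin 7 → F) (j : Fin 4) : g x (Fin.castLE (by omega) j) = 0 := by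
    simp only [g_apply, Finset.sum_apply, Pi.smul_apply, w_zero, smul_zero,
      Finset.sum_const_zero]
  have g_eq_zero (x : Fin 7 → F) (hx : ∀ i, x (ι i) = 0) : g x = 0 := by
    simp [g_apply, hx]
  have g_sq (x : Fin 7 → F) : g (g x) = 0 :=
    g_eq_zero _ fun i => g_head x (Fin.castLE (by omega) i)
  let f := LinearEquiv.subOfSqZero g g_sq
  have f_apply (x : Fin 7 → F) : f x = x - g x := rfl
  have f_Z1 (x : Fin 7 → F) (hx : x ∈ coordZero F ({0, 1, 2, 3} : Set (Fin 7))) :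
      f x = x := by
    rw [f_apply, g_eq_zero, sub_zero]
    intro i
    apply hx
    fin_cases i <;> simp [ι]
  have f_v (i : Fin 3) : f (v i) = Pi.single (ι i) 1 := by
    have : g (v i) = v i - Pi.single (ι i) 1 := by
      have hvι (j : Fin 3) : v i (ι j) = if j = i then 1 else 0 := by
        simpa [ι, Fin.ext_iff] using hvc i (Fin.castLE (by omega) j)
      simp [g_apply, hvι]
    rw [f_apply, this, sub_sub_cancel]
  have X_span (x : Fin 7 → F) (hx : x ∈ X) : x = ∑ i, x (ι i) • v i := by
    have x3 : x 3 = 0 := by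
      have : projFirst4 F x ∈ coordZero F ({3} : Set (Fin 4)) :=
        hXp ▸ Submodule.mem_map_of_mem hx
      exact this 3 rfl
    have hmem : x - ∑ i, x (ι i) • v i ∈
        X ⊓ coordZero F ({0, 1, 2, 3} : Set (Fin 7)) := by
      refine ⟨X.sub_mem hx (X.sum_mem fun i _ => X.smul_mem _ (hvX i)), ?_⟩
      have key (j : Fin 4) :
          (x - ∑ i, x (ι i) • v i) (Fin.castLE (by omega) j) = 0 := by
        simp only [Pi.sub_apply, Finset.sum_apply, Pi.smul_apply, hvc]
        fin_cases j <;> simp [Fin.sum_univ_three, ι, Fin.ext_iff]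
        exact x3
      rintro j (rfl | rfl | rfl | rfl)
      exacts [key 0, key 1, key 2, key 3]
    rw [hXZ, Submodule.mem_bot] at hmem
    exact sub_eq_zero.1 hmem
  refine ⟨f, ?_, hS.map_linearEquiv f, ⟨_, hZ1, ?_⟩, ⟨X, hXS, ?_⟩⟩
  · intro x i hi
    rw [f_apply, Pi.sub_apply, sub_eq_self]
    rcases hi with rfl | rfl | rfl | rfl
    exacts [g_head x 0, g_head x 1, g_head x 2, g_head x 3]
  · ext y
    constructor
    · rintro ⟨x, hx, rfl⟩
      exact (f_Z1 x hx).symm ▸ hx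
    · exact fun hy => ⟨y, hy, f_Z1 y hy⟩
  · ext y
    constructor
    · rintro ⟨x, hx, rfl⟩
      rw [X_span x hx]
      rintro j hj
      simp only [LinearEquiv.coe_coe, map_sum, map_smul, f_v, Finset.sum_apply,
        Pi.smul_apply, Pi.single_apply]
      rcases hj with rfl | rfl | rfl | rfl <;> simp [Fin.sum_univ_three, ι, Fin.ext_iff]
    · intro hy
      refine ⟨∑ i, y (ι i) • v i, X.sum_mem fun i _ => X.smul_mem _ (hvX i), ?_⟩
      have y3 := hy 3 (by simp)
      have y4 := hy 4 (by simp)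
      have y5 := hy 5 (by simp)
      have y6 := hy 6 (by simp)
      ext j
      simp only [LinearEquiv.coe_coe, map_sum, map_smul, f_v, Finset.sum_apply,
        Pi.smul_apply, Pi.single_apply]
      fin_cases j <;> simp [Fin.sum_univ_three, ι, Fin.ext_iff, y3, y4, y5, y6]
end

section
/- Let S be a q-Steiner system S_q(2,3,7) containing both blocks Z₁ = {x ∈ 𝔽^7 : x₁ = x₂ = x₃ = x₄ = 0} and Z₂ = {x ∈ 𝔽^7 : x₄ = x₅ = x₆ = x₇ = 0}. Then the number of blocks B ∈ S with B ≠ Z₁ such that B ∩ Z₁ ≠ {0} and B ∩ Z₂ = {0} is exactly (q² + q + 1)(q⁴ − q − 1); by symmetry, the same count holds for blocks B ≠ Z₂ with B ∩ Z₂ ≠ {0} and B ∩ Z₁ = {0}. -/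
section SteinerCounting

open Finset

open scoped Classical in
theorem Submodule.card_filter_mem {F V : Type*} [Field F] [Fintype F] [AddCommGroup V]
    [Module F V] [Fintype V] (W : Submodule F V) :
    #{x : V | x ∈ W} = Fintype.card F ^ Module.finrank F W := by
  rw [← Module.card_eq_pow_finrank (K := F) (V := W), Fintype.card_subtype]

open scoped Classical in
theorem Submodule.card_filter_mem_ne_zero {F V : Type*} [Field F] [Fintype F] [AddCommGroup V]
    [Module F V] [Fintype V] (W : Submodule F V) :
    #{x : V | x ∈ W ∧ x ≠ 0} = Fintype.card F ^ Module.finrank F W - 1 := by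
  rw [← W.card_filter_mem, ← Finset.filter_filter, Finset.filter_ne',
    Finset.card_erase_of_mem (by simp)]

open scoped Classical in
theorem Submodule.card_filter_mem_notMem_span {F V : Type*} [Field F] [Fintype F]
    [AddCommGroup V] [Module F V] [Fintype V] (W : Submodule F V) {v : V} (hv : v ≠ 0)
    (hvW : v ∈ W) :
    #{x : V | x ∈ W ∧ x ∉ Submodule.span F {v}} =
      Fintype.card F ^ Module.finrank F W - Fintype.card F := by
  have hspan := (Submodule.span F {v}).card_filter_mem
  rw [finrank_span_singleton hv, pow_one] at hspan
  rw [← W.card_filter_mem, ← hspan, ← Finset.card_sdiff_of_subset]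
  · congr 1
    ext x
    simp
  · intro x hx
    simp only [Finset.mem_filter, Finset.mem_univ, true_and] at hx ⊢
    exact (Submodule.span_singleton_le_iff_mem v W).2 hvW hx

theorem finrank_span_pair_of_notMem {F V : Type*} [Field F] [AddCommGroup V] [Module F V]
    {v w : V} (hv : v ≠ 0) (hw : w ∉ Submodule.span F {v}) :
    Module.finrank F (Submodule.span F {v, w}) = 2 := by
  have hli : LinearIndependent F ![v, w] := by
    rw [LinearIndependent.pair_iff' hv]
    exact fun a ha => hw (Submodule.mem_span_singleton.2 ⟨a, ha⟩)
  have hrange : Set.range ![v, w] = {v, w} := by simp [Matrix.range_cons, Set.pair_comm]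
  rw [← hrange, finrank_span_eq_card hli, Fintype.card_fin]

namespace IsSteinerSystem

variable {F : Type} [Field F] {k n : ℕ} {S : Set (Submodule F (Fin n → F))}

theorem existsUnique_block (hS : IsSteinerSystem F 2 k n S) {v w : Fin n → F} (hv : v ≠ 0)
    (hw : w ∉ Submodule.span F {v}) : ∃! B, B ∈ S ∧ v ∈ B ∧ w ∈ B := by
  simpa [Submodule.span_le, Set.insert_subset_iff] using
    hS.2 _ (finrank_span_pair_of_notMem hv hw)

theorem inf_eq_span (hS : IsSteinerSystem F 2 k n S) {B C : Submodule F (Fin n → F)}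
    (hB : B ∈ S) (hC : C ∈ S) (hBC : B ≠ C) {v : Fin n → F} (hv : v ≠ 0) (hvB : v ∈ B)
    (hvC : v ∈ C) : B ⊓ C = Submodule.span F {v} := by
  refine le_antisymm (fun w hw => ?_) ?_
  · by_contra hwv
    exact hBC ((hS.existsUnique_block hv hwv).unique ⟨hB, hvB, hw.1⟩ ⟨hC, hvC, hw.2⟩)
  · rw [Submodule.span_singleton_le_iff_mem]
    exact ⟨hvB, hvC⟩

theorem finrank_inf (hS : IsSteinerSystem F 2 k n S) {B C : Submodule F (Fin n → F)}
    (hB : B ∈ S) (hC : C ∈ S) (hBC : B ≠ C) (h : B ⊓ C ≠ ⊥) :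
    Module.finrank F (B ⊓ C : Submodule F (Fin n → F)) = 1 := by
  obtain ⟨v, hv, hv0⟩ := Submodule.exists_mem_ne_zero_of_ne_bot h
  rw [hS.inf_eq_span hB hC hBC hv0 hv.1 hv.2, finrank_span_singleton hv0]

variable [Fintype F]

open scoped Classical in
/-- The number of blocks through a point, with denominators cleared. -/
theorem card_blocks_through_mul (hS : IsSteinerSystem F 2 k n S) {v : Fin n → F} (hv : v ≠ 0) :
    #{B | B ∈ S ∧ v ∈ B} * (Fintype.card F ^ k - Fintype.card F) =
      Fintype.card F ^ n - Fintype.card F := by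
  have hpts := (⊤ : Submodule F (Fin n → F)).card_filter_mem_notMem_span hv trivial
  simp only [Submodule.mem_top, true_and, finrank_top, Module.finrank_fin_fun] at hpts
  rw [← hpts]
  refine (Finset.card_mul_eq_card_mul (fun w (B : Submodule F (Fin n → F)) => w ∈ B)
    (fun w hw => ?_) (fun B hB => ?_)).symm.trans (mul_one _)
  · simp only [Finset.mem_filter, Finset.mem_univ, true_and] at hw
    rw [Finset.card_eq_one, Finset.singleton_iff_unique_mem]
    simpa [Finset.bipartiteAbove, and_assoc] using hS.existsUnique_block hv hw
  · simp only [Finset.mem_filter, Finset.mem_univ, true_and] at hB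
    rw [← hS.1 B hB.1, ← B.card_filter_mem_notMem_span hv hB.2]
    congr 1
    ext x
    simp [Finset.bipartiteBelow, and_comm]

open scoped Classical in
/-- The number of blocks through a point outside a block `Z` that meet `Z`, with denominators
cleared. -/
theorem card_blocks_through_meeting_mul (hS : IsSteinerSystem F 2 k n S)
    {Z : Submodule F (Fin n → F)} (hZ : Z ∈ S) {v : Fin n → F} (hv : v ∉ Z) :
    #{B | B ∈ S ∧ v ∈ B ∧ B ⊓ Z ≠ ⊥} * (Fintype.card F - 1) = Fintype.card F ^ k - 1 := by
  have hv0 : v ≠ 0 := fun h => hv (h ▸ Z.zero_mem)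
  rw [← hS.1 Z hZ, ← Z.card_filter_mem_ne_zero]
  refine (Finset.card_mul_eq_card_mul (fun w (B : Submodule F (Fin n → F)) => w ∈ B)
    (fun w hw => ?_) (fun B hB => ?_)).symm.trans (mul_one _)
  · simp only [Finset.mem_filter, Finset.mem_univ, true_and] at hw
    have hwv : w ∉ Submodule.span F {v} := by
      rw [Submodule.mem_span_singleton]
      rintro ⟨a, rfl⟩
      have ha : a ≠ 0 := fun h => hw.2 (by simp [h])
      exact hv ((Z.smul_mem_iff ha).1 hw.1)
    obtain ⟨B, hB, hBuniq⟩ := hS.existsUnique_block hv0 hwv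
    rw [Finset.card_eq_one]
    refine ⟨B, Finset.eq_singleton_iff_unique_mem.2 ⟨?_, fun C hC => ?_⟩⟩
    · simp only [Finset.mem_bipartiteAbove, Finset.mem_filter, Finset.mem_univ, true_and]
      exact ⟨⟨hB.1, hB.2.1, Submodule.ne_bot_iff _ |>.2 ⟨w, ⟨hB.2.2, hw.1⟩, hw.2⟩⟩, hB.2.2⟩
    · simp only [Finset.mem_bipartiteAbove, Finset.mem_filter, Finset.mem_univ, true_and] at hC
      exact hBuniq C ⟨hC.1.1, hC.1.2.1, hC.2⟩
  · simp only [Finset.mem_filter, Finset.mem_univ, true_and] at hB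
    have hBZ : B ≠ Z := fun h => hv (h ▸ hB.2.1)
    have hcard := (B ⊓ Z).card_filter_mem_ne_zero
    rw [hS.finrank_inf hB.1 hZ hBZ hB.2.2, pow_one] at hcard
    rw [← hcard]
    congr 1
    ext x
    simp only [Finset.mem_bipartiteBelow, Finset.mem_filter, Finset.mem_univ, true_and,
      Submodule.mem_inf]
    tauto

open scoped Classical in
theorem card_blocks_through_eq_add {Z Z' : Submodule F (Fin n → F)} (hZ : Z ∈ S)
    (hZZ' : Z ⊓ Z' = ⊥) {v : Fin n → F} (hv : v ∈ Z) :
    #{B | B ∈ S ∧ v ∈ B} =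
      #{B | B ∈ S ∧ B ≠ Z ∧ v ∈ B ∧ B ⊓ Z' = ⊥} + 1 + #{B | B ∈ S ∧ v ∈ B ∧ B ⊓ Z' ≠ ⊥} := by
  rw [← Finset.card_filter_add_card_filter_not (s := {B | B ∈ S ∧ v ∈ B})
    (fun B => B ⊓ Z' = ⊥), Finset.filter_filter, Finset.filter_filter]
  congr 1
  · rw [← Finset.card_erase_add_one (a := Z) (by simp [hZ, hv, hZZ'])]
    congr 2
    ext B
    simp only [Finset.mem_erase, Finset.mem_filter, Finset.mem_univ, true_and]
    tauto
  · simp only [and_assoc]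

open scoped Classical in
/-- Double counting of the pairs of a nonzero vector of `Z` and a block through it meeting `Z`
but not a second given subspace. -/
theorem card_blocks_meeting_only_mul (hS : IsSteinerSystem F 2 k n S)
    {Z Z' : Submodule F (Fin n → F)} (hZ : Z ∈ S) {m : ℕ}
    (hm : ∀ v ∈ Z, v ≠ 0 → #{B | B ∈ S ∧ B ≠ Z ∧ v ∈ B ∧ B ⊓ Z' = ⊥} = m) :
    #{B | B ∈ S ∧ B ≠ Z ∧ B ⊓ Z ≠ ⊥ ∧ B ⊓ Z' = ⊥} * (Fintype.card F - 1) =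
      (Fintype.card F ^ k - 1) * m := by
  rw [← hS.1 Z hZ, ← Z.card_filter_mem_ne_zero]
  refine (Finset.card_mul_eq_card_mul (fun w (B : Submodule F (Fin n → F)) => w ∈ B)
    (fun w hw => ?_) (fun B hB => ?_)).symm
  · simp only [Finset.mem_filter, Finset.mem_univ, true_and] at hw
    rw [← hm w hw.1 hw.2]
    congr 1
    ext B
    simp only [Finset.mem_bipartiteAbove, Finset.mem_filter, Finset.mem_univ, true_and]
    have hmeet : w ∈ B → B ⊓ Z ≠ ⊥ := fun h =>
      (Submodule.ne_bot_iff _).2 ⟨w, ⟨h, hw.1⟩, hw.2⟩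
    tauto
  · simp only [Finset.mem_filter, Finset.mem_univ, true_and] at hB
    have hcard := (B ⊓ Z).card_filter_mem_ne_zero
    rw [hS.finrank_inf hB.1 hZ hB.2.1 hB.2.2.1, pow_one] at hcard
    rw [← hcard]
    congr 1
    ext x
    simp only [Finset.mem_bipartiteBelow, Finset.mem_filter, Finset.mem_univ, true_and,
      Submodule.mem_inf]
    tauto

/-- In an `S_q(2,3,7)`, the number of blocks other than `Z` that meet the block `Z` but not another
block disjoint from it. -/
theorem ncard_blocks_meeting_only {S : Set (Submodule F (Fin 7 → F))}
    (hS : IsSteinerSystem F 2 3 7 S) {Z Z' : Submodule F (Fin 7 → F)} (hZ : Z ∈ S)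
    (hZ' : Z' ∈ S) (hZZ' : Z ⊓ Z' = ⊥) :
    {B ∈ S | B ≠ Z ∧ B ⊓ Z ≠ ⊥ ∧ B ⊓ Z' = ⊥}.ncard =
      (Fintype.card F ^ 2 + Fintype.card F + 1) *
        (Fintype.card F ^ 4 - Fintype.card F - 1) := by
  classical
  have hq : 2 ≤ Fintype.card F := Fintype.one_lt_card
  have hgeom : Fintype.card F ^ 3 - 1 =
      (Fintype.card F ^ 2 + Fintype.card F + 1) * (Fintype.card F - 1) := by
    obtain ⟨r, hr⟩ := Nat.exists_eq_add_of_le' hq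
    rw [hr, Nat.add_sub_assoc (by norm_num), Nat.sub_eq_iff_eq_add (Nat.one_le_pow _ _ (by lia))]
    ring
  have hlocal : ∀ v ∈ Z, v ≠ 0 → #{B | B ∈ S ∧ B ≠ Z ∧ v ∈ B ∧ B ⊓ Z' = ⊥} =
      Fintype.card F ^ 4 - Fintype.card F - 1 := by
    intro v hv hv0
    have hvZ' : v ∉ Z' := fun h => hv0 ((Submodule.mem_bot F).1 (hZZ' ▸ ⟨hv, h⟩))
    have hall : #{B | B ∈ S ∧ v ∈ B} = Fintype.card F ^ 4 + Fintype.card F ^ 2 + 1 := by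
      have hlt : Fintype.card F < Fintype.card F ^ 3 := lt_self_pow₀ hq (by norm_num)
      have hle : Fintype.card F ≤ Fintype.card F ^ 7 := Nat.le_self_pow (by norm_num) _
      refine Nat.eq_of_mul_eq_mul_right (Nat.sub_pos_of_lt hlt) ?_
      rw [hS.card_blocks_through_mul hv0]
      zify [hlt.le, hle]
      ring
    have hmeet : #{B | B ∈ S ∧ v ∈ B ∧ B ⊓ Z' ≠ ⊥} =
        Fintype.card F ^ 2 + Fintype.card F + 1 :=
      Nat.eq_of_mul_eq_mul_right (Nat.sub_pos_of_lt hq)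
        ((hS.card_blocks_through_meeting_mul hZ' hvZ').trans hgeom)
    have hsum := card_blocks_through_eq_add hZ hZZ' hv
    lia
  have hcount := hS.card_blocks_meeting_only_mul hZ hlocal
  rw [hgeom, mul_right_comm] at hcount
  rw [← Nat.eq_of_mul_eq_mul_right (Nat.sub_pos_of_lt hq) hcount, ← Set.ncard_coe_finset]
  congr 1
  ext B
  simp

end IsSteinerSystem

theorem coordZero_inf_coordZero_eq_bot {F : Type} [Field F] {n : ℕ} {s t : Set (Fin n)}
    (h : s ∪ t = Set.univ) : coordZero F s ⊓ coordZero F t = ⊥ := by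
  rw [eq_bot_iff]
  intro x hx
  rw [Submodule.mem_bot]
  funext i
  have hi : i ∈ s ∪ t := h ▸ Set.mem_univ i
  exact hi.elim (hx.1 i) (hx.2 i)

end SteinerCounting

/-- In a `q`-Steiner system `S_q(2,3,7)` containing both `Z₁ = {x : x₁ = x₂ = x₃ = x₄ = 0}`
and `Z₂ = {x : x₄ = x₅ = x₆ = x₇ = 0}`, the number of blocks `B ≠ Z₁` with `B ⊓ Z₁ ≠ ⊥`
and `B ⊓ Z₂ = ⊥` is exactly `(q²+q+1)(q⁴−q−1)`; by symmetry the same count holds for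
blocks `B ≠ Z₂` with `B ⊓ Z₂ ≠ ⊥` and `B ⊓ Z₁ = ⊥`. -/
theorem steiner_237_meet_only_one_count (q : ℕ) (F : Type) [Field F] [Fintype F]
    (hq : Fintype.card F = q)
    (S : Set (Submodule F (Fin 7 → F))) (hS : IsSteinerSystem F 2 3 7 S)
    (hZ1 : coordZero F ({0, 1, 2, 3} : Set (Fin 7)) ∈ S)
    (hZ2 : coordZero F ({3, 4, 5, 6} : Set (Fin 7)) ∈ S) :
    {B ∈ S | B ≠ coordZero F ({0, 1, 2, 3} : Set (Fin 7)) ∧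
        B ⊓ coordZero F ({0, 1, 2, 3} : Set (Fin 7)) ≠ ⊥ ∧
        B ⊓ coordZero F ({3, 4, 5, 6} : Set (Fin 7)) = ⊥}.ncard =
      (q ^ 2 + q + 1) * (q ^ 4 - q - 1) ∧
    {B ∈ S | B ≠ coordZero F ({3, 4, 5, 6} : Set (Fin 7)) ∧
        B ⊓ coordZero F ({3, 4, 5, 6} : Set (Fin 7)) ≠ ⊥ ∧
        B ⊓ coordZero F ({0, 1, 2, 3} : Set (Fin 7)) = ⊥}.ncard =
      (q ^ 2 + q + 1) * (q ^ 4 - q - 1) := by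
  subst hq
  have hinf : coordZero F ({0, 1, 2, 3} : Set (Fin 7)) ⊓ coordZero F {3, 4, 5, 6} = ⊥ := by
    refine coordZero_inf_coordZero_eq_bot (Set.eq_univ_of_forall fun i => ?_)
    fin_cases i <;> simp
  exact ⟨hS.ncard_blocks_meeting_only hZ1 hZ2 hinf,
    hS.ncard_blocks_meeting_only hZ2 hZ1 ((inf_comm _ _).trans hinf)⟩
end

section
/- Let S be a q-Steiner system S_q(2,3,7) containing both blocks Z₁ = {x ∈ 𝔽^7 : x₁ = x₂ = x₃ = x₄ = 0} and Z₂ = {x ∈ 𝔽^7 : x₄ = x₅ = x₆ = x₇ = 0}. Then the number of blocks B ∈ S with B ∩ Z₁ = {0} and B ∩ Z₂ = {0} (equivalently, blocks whose projections onto the first four coordinates and onto the last four coordinates are both 3-dimensional) is exactly q(q⁷ − q⁵ − q⁴ − 2q³ + q² + 2q + 2). -/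
open Finset Module

section DoubleCounting

variable {F V : Type*} [Field F] [AddCommGroup V] [Module F V]

/-- Every 2-dimensional subspace lies in exactly one member of `S`. -/
def CoversPlanesOnce (S : Finset (Submodule F V)) : Prop :=
  ∀ T : Submodule F V, finrank F T = 2 → ∃! B, B ∈ S ∧ T ≤ B

variable {S : Finset (Submodule F V)}

theorem CoversPlanesOnce.existsUnique_of_not_mem_span (hS : CoversPlanesOnce S) {v w : V}
    (hv : v ≠ 0) (hw : w ∉ F ∙ v) : ∃! B, B ∈ S ∧ v ∈ B ∧ w ∈ B := by
  have hli : LinearIndependent F ![v, w] := by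
    rw [LinearIndependent.pair_iff' hv]
    intro a ha
    exact hw (Submodule.mem_span_singleton.2 ⟨a, ha⟩)
  have h := hS (Submodule.span F (Set.range ![v, w])) (by simpa using finrank_span_eq_card hli)
  simpa [Submodule.span_le, Set.insert_subset_iff, and_comm] using h

theorem CoversPlanesOnce.mem_span_of_mem_of_mem (hS : CoversPlanesOnce S) {B C : Submodule F V}
    (hB : B ∈ S) (hC : C ∈ S) (hBC : B ≠ C) {v w : V} (hv : v ≠ 0) (hvB : v ∈ B) (hvC : v ∈ C)
    (hwB : w ∈ B) (hwC : w ∈ C) : w ∈ F ∙ v := by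
  by_contra hw
  exact hBC ((hS.existsUnique_of_not_mem_span hv hw).unique ⟨hB, hvB, hwB⟩ ⟨hC, hvC, hwC⟩)

theorem CoversPlanesOnce.finrank_inf_eq_one (hS : CoversPlanesOnce S) {B C : Submodule F V}
    (hB : B ∈ S) (hC : C ∈ S) (hBC : B ≠ C) (hne : B ⊓ C ≠ ⊥) :
    finrank F (B ⊓ C : Submodule F V) = 1 := by
  obtain ⟨v, ⟨hvB, hvC⟩, hv⟩ := Submodule.exists_mem_ne_zero_of_ne_bot hne
  have : B ⊓ C = F ∙ v := by
    refine le_antisymm (fun w hw => ?_) ?_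
    · exact hS.mem_span_of_mem_of_mem hB hC hBC hv hvB hvC hw.1 hw.2
    · rw [Submodule.span_singleton_le_iff_mem]
      exact ⟨hvB, hvC⟩
  rw [this, finrank_span_singleton hv]

open Classical in
/-- Inclusion-exclusion for blocks meeting neither of two disjoint nonzero blocks. -/
theorem card_meeting_neither {Y Z : Submodule F V} (hY : Y ∈ S) (hZ : Z ∈ S)
    (hY0 : Y ≠ ⊥) (hZ0 : Z ≠ ⊥) (hYZ : Y ⊓ Z = ⊥) :
    (#{B ∈ S | B ⊓ Y = ⊥ ∧ B ⊓ Z = ⊥} : ℤ) =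
      #S - 2 - #{B ∈ S | B ≠ Y ∧ B ⊓ Y ≠ ⊥} - #{B ∈ S | B ≠ Z ∧ B ⊓ Z ≠ ⊥} +
        #{B ∈ S | (B ≠ Y ∧ B ⊓ Y ≠ ⊥) ∧ (B ≠ Z ∧ B ⊓ Z ≠ ⊥)} := by
  have hne : Y ≠ Z := by
    rintro rfl
    exact hY0 (by simpa using hYZ)
  have hu := card_union_add_card_inter {B ∈ S | B ≠ Y ∧ B ⊓ Y ≠ ⊥} {B ∈ S | B ≠ Z ∧ B ⊓ Z ≠ ⊥}
  rw [← filter_or, ← filter_and] at hu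
  have hT : #{B ∈ S | (B ≠ Y ∧ B ⊓ Y ≠ ⊥) ∨ (B ≠ Z ∧ B ⊓ Z ≠ ⊥)} + 2 =
      #{B ∈ S | ¬ (B ⊓ Y = ⊥ ∧ B ⊓ Z = ⊥)} := by
    rw [← card_pair hne, ← card_union_of_disjoint]
    · congr 1
      ext B
      simp only [mem_union, mem_filter, mem_insert, mem_singleton]
      constructor
      · rintro (h | rfl | rfl)
        · tauto
        · simp [hY, hY0]
        · simp [hZ, hZ0]
      · tauto
    · rw [disjoint_right]
      have hZY : Z ⊓ Y = ⊥ := inf_comm Y Z ▸ hYZ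
      simp [hYZ, hZY]
  have hc := card_filter_add_card_filter_not (s := S) (fun B => B ⊓ Y = ⊥ ∧ B ⊓ Z = ⊥)
  omega

variable [Fintype F] [Fintype V]

open Classical in
theorem card_nonzero_mem_add_one (W : Submodule F V) :
    #{v : V | v ∈ W ∧ v ≠ 0} + 1 = Fintype.card F ^ finrank F W := by
  have h0 : #{v : V | v ∈ W} = Fintype.card F ^ finrank F W := by
    rw [← Module.card_eq_pow_finrank (K := F) (V := W), Fintype.card_subtype]
  have h1 : ({v : V | v ∈ W ∧ v ≠ 0} : Finset V) = ({v : V | v ∈ W} : Finset V).erase 0 := by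
    ext v; simp [and_comm]
  rw [h1, card_erase_add_one (by simp), h0]

open Classical in
theorem card_mem_not_mem_span_singleton_add {W : Submodule F V} {v : V} (hv : v ≠ 0)
    (hvW : v ∈ W) :
    #{w : V | w ∉ F ∙ v ∧ w ∈ W} + Fintype.card F = Fintype.card F ^ finrank F W := by
  have hW : #{w : V | w ∈ W} = Fintype.card F ^ finrank F W := by
    rw [← Module.card_eq_pow_finrank (K := F) (V := W), Fintype.card_subtype]
  have hs : #{w : V | w ∈ F ∙ v} = Fintype.card F := by
    rw [← Fintype.card_subtype, Module.card_eq_pow_finrank (K := F) (V := F ∙ v),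
      finrank_span_singleton hv, pow_one]
  have hle : F ∙ v ≤ W := (Submodule.span_singleton_le_iff_mem v W).2 hvW
  rw [← hW, ← hs, ← card_union_of_disjoint]
  · congr 1
    ext w
    by_cases hw : w ∈ F ∙ v
    · simp [hw, hle hw]
    · simp [hw]
  · rw [disjoint_left]
    simp +contextual

open Classical in
/-- Blocks through a given nonzero vector. -/
theorem CoversPlanesOnce.card_mem_mul (hS : CoversPlanesOnce S) {k : ℕ}
    (hk : ∀ B ∈ S, finrank F B = k) {v : V} (hv : v ≠ 0) :
    (#{B ∈ S | v ∈ B} : ℤ) * ((Fintype.card F : ℤ) ^ k - Fintype.card F) =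
      (Fintype.card F : ℤ) ^ finrank F V - Fintype.card F := by
  have h := card_mul_eq_card_mul (s := ({w : V | w ∉ F ∙ v} : Finset V))
    (t := ({B ∈ S | v ∈ B} : Finset (Submodule F V))) (fun w B => w ∈ B) (m := 1)
    (n := Fintype.card F ^ k - Fintype.card F) ?_ ?_
  · have h1 := card_mem_not_mem_span_singleton_add (W := (⊤ : Submodule F V)) hv trivial
    simp only [Submodule.mem_top, and_true, finrank_top] at h1
    by_cases hne : #{B ∈ S | v ∈ B} = 0
    · rw [hne] at h ⊢
      have h2 : (Fintype.card F : ℤ) = (Fintype.card F : ℤ) ^ finrank F V := by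
        rw [← Nat.cast_pow, ← h1]
        simp only [zero_mul, mul_one] at h
        rw [h]; simp
      rw [← h2]; simp
    · obtain ⟨B, hB⟩ := card_pos.1 (Nat.pos_of_ne_zero hne)
      rw [mem_filter] at hB
      have h3 := card_mem_not_mem_span_singleton_add hv hB.2
      rw [hk B hB.1] at h3
      have h4 : Fintype.card F ≤ Fintype.card F ^ k := by omega
      zify [h4] at h h1
      linarith
  · intro w hw
    simp only [mem_filter, mem_univ, true_and] at hw
    rw [card_eq_one]
    obtain ⟨B, hB, hB'⟩ := hS.existsUnique_of_not_mem_span hv hw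
    refine ⟨B, ?_⟩
    ext C
    simp only [bipartiteAbove, mem_filter, mem_singleton]
    exact ⟨fun h => hB' C ⟨h.1.1, h.1.2, h.2⟩, fun h => h ▸ ⟨⟨hB.1, hB.2.1⟩, hB.2.2⟩⟩
  · intro B hB
    rw [mem_filter] at hB
    have h3 := card_mem_not_mem_span_singleton_add hv hB.2
    rw [hk B hB.1] at h3
    rw [← h3]
    simp [bipartiteBelow, filter_filter]

open Classical in
/-- All blocks, given the number `r` of blocks through a nonzero vector. -/
theorem card_blocks_mul {k r : ℕ} (hk : ∀ B ∈ S, finrank F B = k)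
    (hr : ∀ v : V, v ≠ 0 → #{B ∈ S | v ∈ B} = r) :
    (#S : ℤ) * ((Fintype.card F : ℤ) ^ k - 1) =
      ((Fintype.card F : ℤ) ^ finrank F V - 1) * r := by
  have h := card_mul_eq_card_mul (s := ({v : V | v ≠ 0} : Finset V)) (t := S)
    (fun v B => v ∈ B) (m := r) (n := Fintype.card F ^ k - 1) ?_ ?_
  · have h1 := card_nonzero_mem_add_one (⊤ : Submodule F V)
    simp only [Submodule.mem_top, true_and, finrank_top] at h1
    have h4 : 1 ≤ Fintype.card F ^ k := Nat.one_le_pow _ _ Fintype.card_pos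
    zify [h4] at h h1
    rw [← h, ← h1]; ring
  · intro v hv
    exact hr v (by simpa using hv)
  · intro B hB
    have h3 := card_nonzero_mem_add_one B
    rw [hk B hB] at h3
    rw [← h3]
    simp [bipartiteBelow, filter_filter, and_comm]

open Classical in
/-- Blocks other than `Z` meeting `Z`, given the number `r` of blocks through a nonzero vector. -/
theorem CoversPlanesOnce.card_meeting_mul (hS : CoversPlanesOnce S) {k r : ℕ}
    (hk : ∀ B ∈ S, finrank F B = k) (hr : ∀ v : V, v ≠ 0 → #{B ∈ S | v ∈ B} = r)
    {Z : Submodule F V} (hZ : Z ∈ S) (hr1 : 1 ≤ r) :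
    (#{B ∈ S | B ≠ Z ∧ B ⊓ Z ≠ ⊥} : ℤ) * (Fintype.card F - 1) =
      ((Fintype.card F : ℤ) ^ k - 1) * (r - 1) := by
  have h := card_mul_eq_card_mul (s := ({v : V | v ∈ Z ∧ v ≠ 0} : Finset V))
    (t := ({B ∈ S | B ≠ Z ∧ B ⊓ Z ≠ ⊥} : Finset (Submodule F V)))
    (fun v B => v ∈ B) (m := r - 1) (n := Fintype.card F - 1) ?_ ?_
  · have h1 := card_nonzero_mem_add_one Z
    rw [hk Z hZ] at h1
    have h4 : 1 ≤ Fintype.card F := Fintype.card_pos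
    zify [h4, hr1] at h h1
    rw [← h, ← h1]; ring
  · intro v hv
    simp only [mem_filter, mem_univ, true_and] at hv
    rw [← hr v hv.2, ← card_erase_of_mem (a := Z) (by simp [hZ, hv.1])]
    congr 1
    ext B
    simp only [bipartiteAbove, mem_filter, mem_erase]
    refine ⟨fun h => ⟨h.1.2.1, h.1.1, h.2⟩, fun h => ⟨⟨h.2.1, h.1, fun h0 => hv.2 ?_⟩, h.2.2⟩⟩
    have : v ∈ B ⊓ Z := ⟨h.2.2, hv.1⟩
    rwa [h0, Submodule.mem_bot] at this
  · intro B hB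
    simp only [mem_filter] at hB
    have h3 := card_nonzero_mem_add_one (B ⊓ Z)
    rw [hS.finrank_inf_eq_one hB.1 hZ hB.2.1 hB.2.2, pow_one] at h3
    rw [← h3, Nat.add_sub_cancel, bipartiteBelow, filter_filter]
    congr 1
    ext v
    simp only [mem_filter, mem_univ, true_and, Submodule.mem_inf]
    tauto

open Classical in
/-- Blocks meeting both of two disjoint blocks. -/
theorem CoversPlanesOnce.card_meeting_both_mul (hS : CoversPlanesOnce S) {k : ℕ}
    (hk : ∀ B ∈ S, finrank F B = k) {Y Z : Submodule F V} (hY : Y ∈ S) (hZ : Z ∈ S)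
    (hYZ : Y ⊓ Z = ⊥) :
    (#{B ∈ S | (B ≠ Y ∧ B ⊓ Y ≠ ⊥) ∧ (B ≠ Z ∧ B ⊓ Z ≠ ⊥)} : ℤ) * (Fintype.card F - 1) ^ 2 =
      ((Fintype.card F : ℤ) ^ k - 1) ^ 2 := by
  have h := card_mul_eq_card_mul
    (s := ({v : V | v ∈ Y ∧ v ≠ 0} : Finset V) ×ˢ ({v : V | v ∈ Z ∧ v ≠ 0} : Finset V))
    (t := ({B ∈ S | (B ≠ Y ∧ B ⊓ Y ≠ ⊥) ∧ (B ≠ Z ∧ B ⊓ Z ≠ ⊥)} : Finset (Submodule F V)))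
    (fun p B => p.1 ∈ B ∧ p.2 ∈ B) (m := 1) (n := (Fintype.card F - 1) ^ 2) ?_ ?_
  · have h1 := card_nonzero_mem_add_one Y
    have h2 := card_nonzero_mem_add_one Z
    rw [hk Y hY] at h1
    rw [hk Z hZ] at h2
    have h4 : 1 ≤ Fintype.card F := Fintype.card_pos
    rw [card_product] at h
    zify [h4] at h h1 h2
    rw [← h, pow_two, ← eq_sub_iff_add_eq.2 h1]
    linear_combination (#{v : V | v ∈ Y ∧ v ≠ 0} : ℤ) * (h2 - h1)
  · rintro ⟨v, w⟩ hvw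
    simp only [mem_product, mem_filter, mem_univ, true_and] at hvw
    obtain ⟨⟨hvY, hv⟩, hwZ, hw⟩ := hvw
    have hdisj : ∀ x, x ∈ Y → x ∈ Z → x = 0 := fun x hxY hxZ => by
      have : x ∈ Y ⊓ Z := ⟨hxY, hxZ⟩
      rwa [hYZ, Submodule.mem_bot] at this
    have hspan : w ∉ F ∙ v := fun h =>
      hw (hdisj w ((Submodule.span_singleton_le_iff_mem v Y).2 hvY h) hwZ)
    obtain ⟨B, hB, hB'⟩ := hS.existsUnique_of_not_mem_span hv hspan
    rw [card_eq_one]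
    refine ⟨B, ?_⟩
    ext C
    simp only [bipartiteAbove, mem_filter, mem_singleton]
    refine ⟨fun h => hB' C ⟨h.1.1, h.2.1, h.2.2⟩, ?_⟩
    rintro rfl
    refine ⟨⟨hB.1, ⟨?_, ?_⟩, ?_, ?_⟩, hB.2⟩
    · rintro rfl
      exact hw (hdisj w hB.2.2 hwZ)
    · exact (Submodule.ne_bot_iff _).2 ⟨v, ⟨hB.2.1, hvY⟩, hv⟩
    · rintro rfl
      exact hv (hdisj v hvY hB.2.1)
    · exact (Submodule.ne_bot_iff _).2 ⟨w, ⟨hB.2.2, hwZ⟩, hw⟩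
  · intro B hB
    simp only [mem_filter] at hB
    obtain ⟨hBS, ⟨hBY, hBY'⟩, hBZ, hBZ'⟩ := hB
    have h3 := card_nonzero_mem_add_one (B ⊓ Y)
    have h4 := card_nonzero_mem_add_one (B ⊓ Z)
    rw [hS.finrank_inf_eq_one hBS hY hBY hBY', pow_one] at h3
    rw [hS.finrank_inf_eq_one hBS hZ hBZ hBZ', pow_one] at h4
    rw [pow_two, ← Nat.eq_sub_of_add_eq h3]
    nth_rw 2 [h3.trans h4.symm |> Nat.add_right_cancel]
    rw [← card_product]
    congr 1
    ext ⟨v, w⟩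
    simp only [bipartiteBelow, mem_filter, mem_univ, true_and, mem_product, Submodule.mem_inf]
    tauto

end DoubleCounting

theorem finrank_pi_fin_seven (F : Type) [Field F] : finrank F (Fin 7 → F) = 7 := by
  simp

theorem coordZero_inf_eq_bot (F : Type) [Field F] :
    coordZero F ({0, 1, 2, 3} : Set (Fin 7)) ⊓ coordZero F ({3, 4, 5, 6} : Set (Fin 7)) = ⊥ := by
  refine (Submodule.eq_bot_iff _).2 fun x hx => ?_
  obtain ⟨h1, h2⟩ := hx
  funext i
  by_cases hi : i ∈ ({0, 1, 2, 3} : Set (Fin 7))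
  · exact h1 i hi
  · refine h2 i ?_
    revert hi
    fin_cases i <;> simp

theorem meet_neither_arith {q b r n n' m c : ℤ} (hq : 1 < q) (hr : r * (q ^ 3 - q) = q ^ 7 - q)
    (hb : b * (q ^ 3 - 1) = (q ^ 7 - 1) * r) (hn : n * (q - 1) = (q ^ 3 - 1) * (r - 1))
    (hn' : n' * (q - 1) = (q ^ 3 - 1) * (r - 1)) (hm : m * (q - 1) ^ 2 = (q ^ 3 - 1) ^ 2)
    (hc : c = b - 2 - n - n' + m) :
    c = q * (q ^ 7 - q ^ 5 - q ^ 4 - 2 * q ^ 3 + q ^ 2 + 2 * q + 2) := by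
  have hq1 : q - 1 ≠ 0 := by omega
  have h3 : q ^ 3 - 1 ≠ 0 := by nlinarith [sq_nonneg q]
  have h3q : q ^ 3 - q ≠ 0 := by nlinarith [mul_pos (by omega : 0 < q) (by nlinarith : 0 < q ^ 2 - 1)]
  obtain rfl : r = q ^ 4 + q ^ 2 + 1 := mul_right_cancel₀ h3q (by rw [hr]; ring)
  obtain rfl : n = (q ^ 2 + q + 1) * (q ^ 4 + q ^ 2) := mul_right_cancel₀ hq1 (by rw [hn]; ring)
  obtain rfl : n' = (q ^ 2 + q + 1) * (q ^ 4 + q ^ 2) := mul_right_cancel₀ hq1 (by rw [hn']; ring)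
  obtain rfl : m = (q ^ 2 + q + 1) ^ 2 := mul_right_cancel₀ (pow_ne_zero 2 hq1) (by rw [hm]; ring)
  obtain rfl : b = (q ^ 6 + q ^ 5 + q ^ 4 + q ^ 3 + q ^ 2 + q + 1) * (q ^ 2 - q + 1) :=
    mul_right_cancel₀ h3 (by rw [hb]; ring)
  rw [hc]; ring

/-- In a `q`-Steiner system `S_q(2,3,7)` containing both `Z₁ = {x : x₁ = x₂ = x₃ = x₄ = 0}`
and `Z₂ = {x : x₄ = x₅ = x₆ = x₇ = 0}`, the number of blocks meeting both `Z₁` and `Z₂`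
trivially is exactly `q(q⁷ − q⁵ − q⁴ − 2q³ + q² + 2q + 2)`. -/
theorem steiner_237_meet_neither_count (q : ℕ) (F : Type) [Field F] [Fintype F]
    (hq : Fintype.card F = q)
    (S : Set (Submodule F (Fin 7 → F))) (hS : IsSteinerSystem F 2 3 7 S)
    (hZ1 : coordZero F ({0, 1, 2, 3} : Set (Fin 7)) ∈ S)
    (hZ2 : coordZero F ({3, 4, 5, 6} : Set (Fin 7)) ∈ S) :
    {B ∈ S | B ⊓ coordZero F ({0, 1, 2, 3} : Set (Fin 7)) = ⊥ ∧
        B ⊓ coordZero F ({3, 4, 5, 6} : Set (Fin 7)) = ⊥}.ncard =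
      q * (q ^ 7 - q ^ 5 - q ^ 4 - 2 * q ^ 3 + q ^ 2 + 2 * q + 2) := by
  classical
  subst hq
  have hq : 1 < Fintype.card F := Fintype.one_lt_card
  obtain ⟨hk, hcov⟩ := hS
  set Y := coordZero F ({0, 1, 2, 3} : Set (Fin 7))
  set Z := coordZero F ({3, 4, 5, 6} : Set (Fin 7))
  lift S to Finset (Submodule F (Fin 7 → F)) using S.toFinite
  simp only [Finset.mem_coe] at hk hcov hZ1 hZ2
  have hS : CoversPlanesOnce S := hcov
  have hYZ : Y ⊓ Z = ⊥ := coordZero_inf_eq_bot F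
  have ne_bot : ∀ B ∈ S, B ≠ ⊥ := by
    rintro B hB rfl
    simpa using hk ⊥ hB
  have hqr : ∀ v : Fin 7 → F, v ≠ 0 →
      #{B ∈ S | v ∈ B} = Fintype.card F ^ 4 + Fintype.card F ^ 2 + 1 := by
    intro v hv
    have h := hS.card_mem_mul hk hv
    rw [finrank_pi_fin_seven] at h
    zify at hq ⊢
    refine mul_right_cancel₀ (b := (Fintype.card F : ℤ) ^ 3 - Fintype.card F) ?_ (by rw [h]; ring)
    exact (sub_pos.2 (by simpa using pow_lt_pow_right₀ hq (by norm_num : 1 < 3))).ne'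
  have hb := card_blocks_mul hk hqr
  rw [finrank_pi_fin_seven] at hb
  have key := meet_neither_arith (by exact_mod_cast hq) (by push_cast; ring) hb
    (hS.card_meeting_mul hk hqr hZ1 (by omega)) (hS.card_meeting_mul hk hqr hZ2 (by omega))
    (hS.card_meeting_both_mul hk hZ1 hZ2 hYZ)
    (card_meeting_neither hZ1 hZ2 (ne_bot _ hZ1) (ne_bot _ hZ2) hYZ)
  have hcoe : {B ∈ (S : Set (Submodule F (Fin 7 → F))) | B ⊓ Y = ⊥ ∧ B ⊓ Z = ⊥} =
      ({B ∈ S | B ⊓ Y = ⊥ ∧ B ⊓ Z = ⊥} : Finset _) := by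
    ext B; simp
  simp only [Finset.mem_coe] at hcoe
  simp only [Finset.mem_coe]
  rw [hcoe, Set.ncard_coe_finset]
  generalize Fintype.card F = q at hq key ⊢
  have e1 : q ^ 5 + q ^ 4 + 2 * q ^ 3 ≤ q ^ 7 := by
    obtain ⟨d, rfl⟩ := Nat.exists_eq_add_of_le hq
    simp only [Nat.succ_eq_add_one]
    ring_nf
    omega
  zify
  rw [key]
  push_cast [Nat.cast_sub (by omega : q ^ 5 ≤ q ^ 7), Nat.cast_sub (by omega : q ^ 4 ≤ q ^ 7 - q ^ 5),
    Nat.cast_sub (by omega : 2 * q ^ 3 ≤ q ^ 7 - q ^ 5 - q ^ 4)]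
  ring
end
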